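/- For the weight ρ(x) = |(x¹,x²)| on ℝⁿ (n ≥ 2) and exponents p > 1, s ≠ 2, if v is a smooth function compactly supported in ℝⁿ \ {x : x¹ = x² = 0}, then ∫ |v|^p ρ^{-s} dx ≤ C ∫ |Dv|^p ρ^{p-s} dx, where C depends only on n, p, s. -/

import Mathlib

open MeasureTheory Real

/-- `ρ(x) = |(x¹, x²)|`, the distance from `x` to the codimension-two subspace
`Γ = {x : x¹ = x² = 0}`. -/
noncomputable def rho {n : ℕ} (x : EuclideanSpace ℝ (Fin n)) : ℝ :=
  Real.sqrt (∑ i : Fin n, if (i : ℕ) < 2 then (x i) ^ 2 else 0)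

theorem rho_sq {m : ℕ} (x : EuclideanSpace ℝ (Fin (m + 2))) :
    rho x ^ 2 = x 0 ^ 2 + x 1 ^ 2 := by
  rw [rho, Real.sq_sqrt (Finset.sum_nonneg fun i _ => by split_ifs <;> positivity)]
  simp [Fin.sum_univ_succ]

theorem rho_nonneg {n : ℕ} (x : EuclideanSpace ℝ (Fin n)) : 0 ≤ rho x := Real.sqrt_nonneg _

theorem continuous_rho {n : ℕ} : Continuous (rho : EuclideanSpace ℝ (Fin n) → ℝ) := by
  refine Real.continuous_sqrt.comp (continuous_finsetSum _ fun i _ => ?_)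
  split_ifs <;> fun_prop

/-- The orthogonal projection `x ↦ x'` onto the first two coordinates. -/
noncomputable def planeProj {m : ℕ} (x : EuclideanSpace ℝ (Fin (m + 2))) :
    EuclideanSpace ℝ (Fin (m + 2)) :=
  x 0 • EuclideanSpace.single 0 1 + x 1 • EuclideanSpace.single 1 1

theorem norm_planeProj {m : ℕ} (x : EuclideanSpace ℝ (Fin (m + 2))) :
    ‖planeProj x‖ = rho x := by
  rw [← sq_eq_sq₀ (norm_nonneg _) (rho_nonneg x), rho_sq, planeProj, EuclideanSpace.norm_sq_eq]
  simp [Fin.sum_univ_succ]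
  exact Finset.sum_eq_zero fun i _ => if_neg (by simp [Fin.ext_iff])

/-- Powers of `rho` are `C¹` off the singular subspace and satisfy Euler's identity there. -/
theorem contDiffAt_rho_rpow_and_euler {m : ℕ} {x : EuclideanSpace ℝ (Fin (m + 2))} (hx : rho x ≠ 0)
    (r : ℝ) : ContDiffAt ℝ 1 (fun y : EuclideanSpace ℝ (Fin (m + 2)) => rho y ^ r) x ∧
      fderiv ℝ (fun y : EuclideanSpace ℝ (Fin (m + 2)) => rho y ^ r) x (planeProj x) =
        r * rho x ^ r := by
  have key : (fun y : EuclideanSpace ℝ (Fin (m + 2)) => rho y ^ r) =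
      fun y => (y 0 ^ 2 + y 1 ^ 2) ^ (r / 2) := by
    ext y
    rw [← rho_sq, ← Real.rpow_natCast_mul (rho_nonneg y)]
    congr 1
    push_cast
    ring
  have hne : x 0 ^ 2 + x 1 ^ 2 ≠ 0 := by rw [← rho_sq]; positivity
  have h0 : HasFDerivAt (fun y : EuclideanSpace ℝ (Fin (m + 2)) => y 0)
    (EuclideanSpace.proj (𝕜 := ℝ) (0 : Fin (m + 2)) : EuclideanSpace ℝ (Fin (m + 2)) →L[ℝ] ℝ) x :=
    (EuclideanSpace.proj (𝕜 := ℝ) (0 : Fin (m + 2))).hasFDerivAt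
  have h1 : HasFDerivAt (fun y : EuclideanSpace ℝ (Fin (m + 2)) => y 1)
    (EuclideanSpace.proj (𝕜 := ℝ) (1 : Fin (m + 2)) : EuclideanSpace ℝ (Fin (m + 2)) →L[ℝ] ℝ) x :=
    (EuclideanSpace.proj (𝕜 := ℝ) (1 : Fin (m + 2))).hasFDerivAt
  have hx' := (((h0.pow 2).add (h1.pow 2)).rpow_const (p := r / 2) (Or.inl hne)).fderiv
  refine ⟨?_, ?_⟩
  · rw [key]
    exact ContDiffAt.rpow_const_of_ne (by fun_prop) hne
  · have hr : rho x ^ r = (x 0 ^ 2 + x 1 ^ 2) ^ (r / 2) := congrFun key x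
    rw [key, hr]
    refine (congrArg (fun L => L (planeProj x)) hx').trans ?_
    simp only [planeProj]
    simp
    rw [Real.rpow_sub_one hne]
    field_simp

/-- A Young-type inequality with an explicit constant. -/
theorem mul_rpow_sub_one_mul_le {p ε a b : ℝ} (hp : 1 < p) (hε : 0 < ε) (ha : 0 ≤ a)
    (hb : 0 ≤ b) :
    p * a ^ (p - 1) * b ≤ ε * a ^ p + p * (ε / p) ^ (1 - p) * b ^ p := by
  have hp0 : 0 < p := by linarith
  have hδ : 0 < ε / p := by positivity
  have split : ∀ c : ℝ, 0 ≤ c → c ^ (p - 1) * c = c ^ p := fun c hc => by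
    rw [← Real.rpow_add_one' hc (by linarith), sub_add_cancel]
  rcases le_total b (ε / p * a) with h | h
  · calc p * a ^ (p - 1) * b ≤ p * a ^ (p - 1) * (ε / p * a) := by gcongr
      _ = ε * (a ^ (p - 1) * a) := by field_simp
      _ = ε * a ^ p := by rw [split a ha]
      _ ≤ _ := le_add_of_nonneg_right (by positivity)
  · have h' : a ≤ (ε / p)⁻¹ * b := by rwa [le_inv_mul_iff₀ hδ]
    calc p * a ^ (p - 1) * b ≤ p * ((ε / p)⁻¹ * b) ^ (p - 1) * b := by
          gcongr
      _ = p * (ε / p) ^ (1 - p) * (b ^ (p - 1) * b) := by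
          rw [Real.mul_rpow (by positivity) hb, Real.inv_rpow hδ.le, ← Real.rpow_neg hδ.le, neg_sub]
          ring
      _ = p * (ε / p) ^ (1 - p) * b ^ p := by rw [split b hb]
      _ ≤ _ := le_add_of_nonneg_left (by positivity)

theorem integral_fderiv_planeProj {m : ℕ} {h : EuclideanSpace ℝ (Fin (m + 2)) → ℝ}
    (hcd : ContDiff ℝ 1 h) (hc : HasCompactSupport h) :
    Integrable (fun x => fderiv ℝ h x (planeProj x)) ∧
      ∫ x, fderiv ℝ h x (planeProj x) = -(2 * ∫ x, h x) := by
  have hd : Continuous (fderiv ℝ h) := hcd.continuous_fderiv one_ne_zero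
  have hdiff : Differentiable ℝ h := hcd.differentiable one_ne_zero
  have hInt : Integrable h := hcd.continuous.integrable_of_hasCompactSupport hc
  have main : ∀ i : Fin (m + 2),
      Integrable (fun x : EuclideanSpace ℝ (Fin (m + 2)) =>
        x i * fderiv ℝ h x (EuclideanSpace.single i 1)) ∧
      ∫ x : EuclideanSpace ℝ (Fin (m + 2)), x i * fderiv ℝ h x (EuclideanSpace.single i 1) =
        -∫ x, h x := by
    intro i
    have hi : ∀ x : EuclideanSpace ℝ (Fin (m + 2)),
        fderiv ℝ (fun y : EuclideanSpace ℝ (Fin (m + 2)) => y i) x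
          (EuclideanSpace.single i 1) = 1 := fun x => by
      have : HasFDerivAt (fun y : EuclideanSpace ℝ (Fin (m + 2)) => y i)
          (EuclideanSpace.proj (𝕜 := ℝ) i : EuclideanSpace ℝ (Fin (m + 2)) →L[ℝ] ℝ) x :=
        (EuclideanSpace.proj (𝕜 := ℝ) i).hasFDerivAt
      rw [this.fderiv]
      simp
    have hI : Integrable (fun x : EuclideanSpace ℝ (Fin (m + 2)) =>
        x i * fderiv ℝ h x (EuclideanSpace.single i 1)) :=
      Continuous.integrable_of_hasCompactSupport (by fun_prop)
        ((hc.fderiv_apply (𝕜 := ℝ) _).mul_left)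
    refine ⟨hI, ?_⟩
    rw [integral_mul_fderiv_eq_neg_fderiv_mul_of_integrable]
    · simp [hi]
    · simpa [hi] using hInt
    · exact hI
    · exact Continuous.integrable_of_hasCompactSupport (by fun_prop) hc.mul_left
    · intro x _
      fun_prop
    · exact fun x _ => hdiff x
  have heq : (fun x => fderiv ℝ h x (planeProj x)) = fun x =>
      x 0 * fderiv ℝ h x (EuclideanSpace.single 0 1) +
        x 1 * fderiv ℝ h x (EuclideanSpace.single 1 1) := by
    ext x
    simp [planeProj]
  rw [heq]
  refine ⟨(main 0).1.add (main 1).1, ?_⟩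
  rw [integral_add (main 0).1 (main 1).1, (main 0).2, (main 1).2]
  ring

/-- **Hardy-type inequality with a power weight singular on a codimension-two subspace.**
For `n ≥ 2`, `p > 1` and `s ≠ 2` there is `C = C(n,p,s) > 0` such that for every smooth
function `v` compactly supported in `ℝⁿ \ Γ`,
`∫ |v|^p ρ^{-s} dx ≤ C ∫ |Dv|^p ρ^{p-s} dx`. -/
theorem hardy_codim_two (n : ℕ) (hn : 2 ≤ n) (p s : ℝ) (hp : 1 < p) (hs : s ≠ 2) :
    ∃ C : ℝ, 0 < C ∧
      ∀ v : EuclideanSpace ℝ (Fin n) → ℝ,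
        ContDiff ℝ (⊤ : ℕ∞) v → HasCompactSupport v →
        tsupport v ⊆ {x | rho x ≠ 0} →
        ∫ x, |v x| ^ p * rho x ^ (-s) ≤
          C * ∫ x, ‖fderiv ℝ v x‖ ^ p * rho x ^ (p - s) := by
  obtain ⟨m, rfl⟩ := Nat.exists_eq_add_of_le' hn
  have hp0 : 0 < p := by linarith
  have hε : 0 < |s - 2| / 2 := by
    have := abs_pos.2 (sub_ne_zero.2 hs)
    positivity
  set ε := |s - 2| / 2 with hεdef
  set K := p * (ε / p) ^ (1 - p) with hK
  have hKpos : 0 < K := by positivity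
  refine ⟨K / ε, by positivity, fun v hv hvc hsupp => ?_⟩
  have hv1 : ContDiff ℝ 1 v := hv.of_le (by exact_mod_cast le_top)
  set h := fun x => |v x| ^ p * rho x ^ (-s) with hh_def
  set G := fun x => ‖fderiv ℝ v x‖ ^ p * rho x ^ (p - s) with hG
  have hv_zero : ∀ x ∉ tsupport v, v x = 0 := fun x hx => image_eq_zero_of_notMem_tsupport hx
  have hdv_zero : ∀ x ∉ tsupport v, fderiv ℝ v x = 0 := fun x hx =>
    image_eq_zero_of_notMem_tsupport fun hx' => hx (tsupport_fderiv_subset ℝ hx')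
  have hh_zero : ∀ x ∉ tsupport v, h x = 0 := fun x hx => by
    simp [hh_def, hv_zero x hx, hp0.ne']
  have hG_zero : ∀ x ∉ tsupport v, G x = 0 := fun x hx => by
    simp [hG, hdv_zero x hx, hp0.ne']
  have hhc : HasCompactSupport h := HasCompactSupport.intro hvc hh_zero
  have hGc : HasCompactSupport G := HasCompactSupport.intro hvc hG_zero
  have hhsub : tsupport h ⊆ tsupport v :=
    closure_minimal (fun x hx => by_contra fun hx' => hx (hh_zero x hx')) (isClosed_tsupport v)
  have hGsub : tsupport G ⊆ tsupport v :=
    closure_minimal (fun x hx => by_contra fun hx' => hx (hG_zero x hx')) (isClosed_tsupport v)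
  have hvp : ContDiff ℝ 1 fun x => |v x| ^ p := hv1.norm_rpow hp
  have hh1 : ContDiff ℝ 1 h := contDiff_iff_contDiffAt.2 fun x => by
    by_cases hx : x ∈ tsupport h
    · exact hvp.contDiffAt.mul (contDiffAt_rho_rpow_and_euler (hsupp (hhsub hx)) (-s)).1
    · exact contDiffAt_const.congr_of_eventuallyEq (notMem_tsupport_iff_eventuallyEq.1 hx)
  have hGcont : Continuous G := by
    refine continuous_of_tsupport fun x hx => ContinuousAt.mul ?_
      (continuous_rho.continuousAt.rpow_const (Or.inl (hsupp (hGsub hx))))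
    exact ((hv1.continuous_fderiv one_ne_zero).norm.continuousAt).rpow_const (Or.inr hp0.le)
  have hhI : Integrable h := hh1.continuous.integrable_of_hasCompactSupport hhc
  have hGI : Integrable G := hGcont.integrable_of_hasCompactSupport hGc
  obtain ⟨hDI, hD⟩ := integral_fderiv_planeProj hh1 hhc
  have hbound : ∀ x, |fderiv ℝ h x (planeProj x) + s * h x| ≤ ε * h x + K * G x := by
    intro x
    by_cases hx : x ∈ tsupport v
    · have hρ : 0 < rho x := lt_of_le_of_ne (rho_nonneg x) (Ne.symm (hsupp hx))
      obtain ⟨hρ1, hρ2⟩ := contDiffAt_rho_rpow_and_euler hρ.ne' (-s)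
      have hder : fderiv ℝ h x (planeProj x) + s * h x =
          fderiv ℝ (fun y => |v y| ^ p) x (planeProj x) * rho x ^ (-s) := by
        rw [hh_def, fderiv_fun_mul (hvp.differentiable one_ne_zero x)
          (hρ1.differentiableAt one_ne_zero)]
        simp only [add_apply, smul_apply, smul_eq_mul, hρ2]
        ring
      have hnorm : |fderiv ℝ (fun y => |v y| ^ p) x (planeProj x)| ≤
          p * |v x| ^ (p - 1) * (‖fderiv ℝ v x‖ * rho x) := by
        calc |fderiv ℝ (fun y => |v y| ^ p) x (planeProj x)|
            ≤ ‖fderiv ℝ (fun y => |v y| ^ p) x‖ * ‖planeProj x‖ :=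
              (Real.norm_eq_abs _).ge.trans (ContinuousLinearMap.le_opNorm _ _)
          _ ≤ p * |v x| ^ (p - 1) * ‖fderiv ℝ v x‖ * rho x := by
              rw [norm_planeProj]
              gcongr
              exact norm_fderiv_norm_rpow_le (hv1.differentiable one_ne_zero) hp
          _ = _ := by ring
      rw [hder, abs_mul, abs_of_pos (Real.rpow_pos_of_pos hρ (-s))]
      calc _ ≤ (ε * |v x| ^ p + K * (‖fderiv ℝ v x‖ * rho x) ^ p) * rho x ^ (-s) := by
            gcongr
            exact hnorm.trans (mul_rpow_sub_one_mul_le hp hε (abs_nonneg _) (by positivity))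
        _ = ε * h x + K * G x := by
            simp only [hh_def, hG]
            rw [Real.mul_rpow (norm_nonneg _) hρ.le, sub_eq_add_neg p s, Real.rpow_add hρ]
            ring
    · have hd : fderiv ℝ h x = 0 :=
        image_eq_zero_of_notMem_tsupport fun hx' => hx (hhsub (tsupport_fderiv_subset ℝ hx'))
      simp [hd, hh_zero x hx, hG_zero x hx]
  have hIneq : |(s - 2) * ∫ x, h x| ≤ ε * (∫ x, h x) + K * ∫ x, G x := by
    calc |(s - 2) * ∫ x, h x| = |∫ x, (fderiv ℝ h x (planeProj x) + s * h x)| := by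
          rw [integral_add hDI (hhI.const_mul s), hD, integral_const_mul]
          ring_nf
      _ ≤ ∫ x, |fderiv ℝ h x (planeProj x) + s * h x| := abs_integral_le_integral_abs
      _ ≤ ∫ x, (ε * h x + K * G x) :=
          integral_mono (hDI.add (hhI.const_mul s)).abs
            ((hhI.const_mul ε).add (hGI.const_mul K)) hbound
      _ = _ := by
          rw [integral_add (hhI.const_mul ε) (hGI.const_mul K), integral_const_mul,
            integral_const_mul]
  have hnn : 0 ≤ ∫ x, h x := integral_nonneg fun x =>
    mul_nonneg (by positivity) (Real.rpow_nonneg (rho_nonneg x) _)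
  rw [abs_mul, abs_of_nonneg hnn, show |s - 2| = 2 * ε by rw [hεdef]; ring] at hIneq
  rw [div_mul_eq_mul_div, le_div_iff₀ hε]
  linarith
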